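/- Let τ > 0 have distribution function F_τ satisfying F_τ(t) ∼ A t^b e^{−C/t^d} as t → 0⁺ with A > 0, C > 0, d > 0, b ∈ ℝ, and F_τ(0) = 0. Then p(r) = ∫₀^∞ e^{−rt} dF_τ(t) satisfies p(r) ∼ μ r^{β} exp(−γ r^{d/(d+1)}) as r → ∞, where μ = sqrt(2π A² (Cd)^{(2b+1)/(d+1)}/(d+1)), β = (d−2b)/(2d+2), γ = ((d+1)/d^{d/(d+1)}) C^{1/(d+1)}. -/

import Mathlib

open MeasureTheory ProbabilityTheory Filter Real

/-- The Laplace transform of a law is the weighted integral of its distribution function. -/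
lemma integral_exp_neg_mul_eq_integral_cdf {Ω : Type*} [MeasurableSpace Ω] (P : Measure Ω)
    [IsProbabilityMeasure P] {τ : Ω → ℝ} (hτ : Measurable τ) {r : ℝ} (hr : 0 < r) :
    ∫ ω, exp (-r * τ ω) ∂P = ∫ t, r * exp (-r * t) * (P {ω | τ ω ≤ t}).toReal := by
  have hmono : Measurable fun t : ℝ => P {ω | τ ω ≤ t} := by
    apply Monotone.measurable
    intro s t hst
    exact measure_mono fun ω (h : τ ω ≤ s) => h.trans hst
  rw [integral_eq_lintegral_of_nonneg_ae (.of_forall fun ω => (exp_pos _).le)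
      (by fun_prop),
    integral_eq_lintegral_of_nonneg_ae (.of_forall fun t => by positivity)
      (Measurable.aestronglyMeasurable
        (Measurable.fun_mul (by fun_prop) hmono.ennreal_toReal))]
  congr 1
  have htail (c : ℝ) : ENNReal.ofReal (exp (-r * c)) =
      ∫⁻ t, (Set.Ici c).indicator (fun t => ENNReal.ofReal (r * exp (-r * t))) t := by
    rw [lintegral_indicator measurableSet_Ici, setLIntegral_congr Ioi_ae_eq_Ici.symm,
      ← ofReal_integral_eq_lintegral_ofReal
        ((integrableOn_exp_mul_Ioi (neg_lt_zero.2 hr) c).const_mul r)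
        (.of_forall fun t => by positivity),
      integral_const_mul, integral_exp_mul_Ioi (neg_lt_zero.2 hr)]
    congr 1
    field_simp
  simp_rw [htail]
  rw [lintegral_lintegral_swap]
  · refine lintegral_congr fun t => ?_
    rw [ENNReal.ofReal_mul (by positivity), ENNReal.ofReal_toReal (measure_ne_top _ _),
      ← lintegral_indicator_const (measurableSet_le hτ measurable_const)]
    exact lintegral_congr fun ω => by simp [Set.indicator_apply]
  · have hs : MeasurableSet {p : Ω × ℝ | τ p.1 ≤ p.2} :=
      measurableSet_le (hτ.comp measurable_fst) measurable_snd
    have hm : Measurable fun p : Ω × ℝ => ENNReal.ofReal (r * exp (-r * p.2)) := by fun_prop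
    exact (hm.indicator hs).aemeasurable

lemma exists_rpow_le_mul_exp {s c : ℝ} (hs : 0 ≤ s) (hc : 0 < c) :
    ∃ K : ℝ, 0 < K ∧ ∀ t : ℝ, 0 < t → t ^ s ≤ K * exp (c * t) := by
  rcases hs.eq_or_lt with rfl | hs
  · exact ⟨1, one_pos, fun t ht => by simpa using (mul_pos hc ht).le⟩
  · refine ⟨exp (-s - s * log (c / s)), exp_pos _, fun t ht => ?_⟩
    rw [rpow_def_of_pos ht, ← exp_add, exp_le_exp]
    have h := log_le_sub_one_of_pos (x := t * (c / s)) (by positivity)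
    rw [log_mul ht.ne' (by positivity)] at h
    have h2 := mul_le_mul_of_nonneg_left h hs.le
    have h3 : s * (t * (c / s) - 1) = c * t - s := by field_simp
    rw [h3] at h2
    linarith

/-- The exponent of the Laplace integral, normalised to vanish at its minimum `1`. -/
noncomputable def laplacePhase (d u : ℝ) : ℝ := u - 1 + (u ^ (-d) - 1) / d

lemma sq_div_le_laplacePhase {d u : ℝ} (hd : 0 < d) (hu : 0 < u) :
    (u - 1) ^ 2 / (4 * (1 + |u - 1|)) ≤ laplacePhase d u := by
  have h1 : -log u ≤ (u ^ (-d) - 1) / d := by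
    rw [le_div_iff₀ hd, rpow_def_of_pos hu]
    linarith [add_one_le_exp (log u * -d)]
  have h2 : (u - 1) ^ 2 / (4 * (1 + |u - 1|)) ≤ u - 1 - log u := by
    obtain ⟨s, hs, rfl⟩ : ∃ s : ℝ, 0 < s ∧ s ^ 2 = u := ⟨√u, sqrt_pos.2 hu, sq_sqrt hu.le⟩
    have hlog : log (s ^ 2) ≤ 2 * (s - 1) := by
      rw [log_pow]
      push_cast
      linarith [log_le_sub_one_of_pos hs]
    have habs := le_abs_self (s ^ 2 - 1)
    have hden : (s + 1) ^ 2 ≤ 4 * (1 + |s ^ 2 - 1|) := by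
      nlinarith [sq_nonneg (s - 1), abs_nonneg (s ^ 2 - 1)]
    calc _ ≤ (s - 1) ^ 2 := by
          rw [div_le_iff₀ (by positivity)]
          calc (s ^ 2 - 1) ^ 2 = (s - 1) ^ 2 * (s + 1) ^ 2 := by ring
            _ ≤ _ := by gcongr
      _ ≤ _ := by linarith
  unfold laplacePhase
  linarith

lemma laplacePhase_nonneg {d u : ℝ} (hd : 0 < d) (hu : 0 < u) : 0 ≤ laplacePhase d u :=
  le_trans (by positivity) (sq_div_le_laplacePhase hd hu)

lemma tendsto_laplacePhase_div_sq {d : ℝ} (hd : 0 < d) :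
    Tendsto (fun u => laplacePhase d u / (u - 1) ^ 2) (nhdsWithin 1 {1}ᶜ)
      (nhds ((d + 1) / 2)) := by
  have hpos : ∀ᶠ u : ℝ in nhdsWithin 1 {1}ᶜ, 0 < u :=
    nhdsWithin_le_nhds (lt_mem_nhds one_pos)
  have hne : ∀ᶠ u : ℝ in nhdsWithin 1 {1}ᶜ, u ≠ 1 := self_mem_nhdsWithin
  refine HasDerivAt.lhopital_zero_nhdsNE (f' := fun u => 1 - u ^ (-d - 1))
    (g' := fun u => 2 * (u - 1)) ?_ ?_ ?_ ?_ ?_ ?_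
  · filter_upwards [hpos] with u hu
    have h := ((hasDerivAt_id u).sub_const 1).add
      (((hasDerivAt_rpow_const (p := -d) (Or.inl hu.ne')).sub_const 1).div_const d)
    refine h.congr_deriv ?_
    field_simp
    ring
  · refine .of_forall fun u => ?_
    simpa using ((hasDerivAt_id u).sub_const 1).fun_pow 2
  · filter_upwards [hne] with u hu
    exact mul_ne_zero two_ne_zero (sub_ne_zero.2 hu)
  · have : ContinuousAt (laplacePhase d) 1 := by
      unfold laplacePhase
      fun_prop (disch := simp)
    simpa [laplacePhase, ContinuousAt] using this.tendsto.mono_left nhdsWithin_le_nhds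
  · have : ContinuousAt (fun u : ℝ => (u - 1) ^ 2) 1 := by fun_prop
    simpa [ContinuousAt] using this.tendsto.mono_left nhdsWithin_le_nhds
  · have h : HasDerivAt (fun u : ℝ => 1 - u ^ (-d - 1)) (d + 1) 1 := by
      have := (hasDerivAt_rpow_const (x := 1) (p := -d - 1) (Or.inl one_ne_zero)).const_sub 1
      refine this.congr_deriv ?_
      simp
      ring
    have h2 := (hasDerivAt_iff_tendsto_slope.1 h).div_const 2
    refine h2.congr' ?_
    filter_upwards [hne] with u hu
    have := sub_ne_zero.2 hu
    simp only [slope_def_field, one_rpow]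
    field_simp
    ring

lemma tendsto_mul_laplacePhase {d : ℝ} (hd : 0 < d) (v : ℝ) :
    Tendsto (fun M : ℝ => M * laplacePhase d (1 + v / √M)) atTop
      (nhds ((d + 1) / 2 * v ^ 2)) := by
  rcases eq_or_ne v 0 with rfl | hv
  · simp [laplacePhase]
  have hdiv : Tendsto (fun M : ℝ => 1 + v / √M) atTop (nhds 1) := by
    simpa using (tendsto_sqrt_atTop.const_div_atTop v).const_add 1
  have hlim : Tendsto (fun M : ℝ => 1 + v / √M) atTop (nhdsWithin 1 {1}ᶜ) := by
    refine tendsto_nhdsWithin_iff.2 ⟨hdiv, ?_⟩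
    filter_upwards [eventually_gt_atTop 0] with M hM
    simp [hv, (sqrt_pos.2 hM).ne']
  refine (((tendsto_laplacePhase_div_sq hd).comp hlim).mul_const (v ^ 2)).congr' ?_
  filter_upwards [eventually_gt_atTop 0] with M hM
  have := sq_sqrt hM.le
  have h0 := (sqrt_pos.2 hM).ne'
  simp only [Function.comp, add_sub_cancel_left, div_pow, this]
  field_simp

lemma exists_rpow_mul_exp_le {d : ℝ} (hd : 0 < d) (b : ℝ) :
    ∃ K : ℝ, 0 < K ∧ ∀ u : ℝ, 0 < u → u ^ b * exp u * exp (-2 * laplacePhase d u) ≤ K := by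
  obtain ⟨K, hK, h⟩ : ∃ K : ℝ, 0 < K ∧
      ∀ u : ℝ, 0 < u → u ^ b ≤ K * exp (u + 2 / d * u ^ (-d)) := by
    rcases le_total 0 b with hb | hb
    · obtain ⟨K, hK, h⟩ := exists_rpow_le_mul_exp hb one_pos
      refine ⟨K, hK, fun u hu => (h u hu).trans ?_⟩
      gcongr
      have : 0 ≤ 2 / d * u ^ (-d) := by positivity
      linarith
    · obtain ⟨K, hK, h⟩ := exists_rpow_le_mul_exp (s := -b / d) (c := 2 / d)
        (div_nonneg (neg_nonneg.2 hb) hd.le) (by positivity)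
      refine ⟨K, hK, fun u hu => ?_⟩
      have h1 := h (u ^ (-d)) (by positivity)
      rw [← rpow_mul hu.le, show -d * (-b / d) = b by field_simp] at h1
      refine h1.trans ?_
      gcongr
      linarith
  refine ⟨K * exp (2 + 2 / d), by positivity, fun u hu => ?_⟩
  calc u ^ b * exp u * exp (-2 * laplacePhase d u)
      ≤ K * exp (u + 2 / d * u ^ (-d)) * exp u * exp (-2 * laplacePhase d u) := by
        gcongr
        exact h u hu
    _ = K * exp (2 + 2 / d) := by
        rw [mul_assoc, mul_assoc, ← exp_add, ← exp_add]
        congr 2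
        unfold laplacePhase
        ring

lemma integrable_exp_neg_mul_abs {c : ℝ} (hc : 0 < c) :
    Integrable fun x : ℝ => exp (-c * |x|) := by
  rw [← integrableOn_univ, ← Set.Iic_union_Ioi (a := (0 : ℝ))]
  refine IntegrableOn.union ?_ ?_
  · refine (integrableOn_exp_mul_Iic hc 0).congr_fun (fun x hx => ?_) measurableSet_Iic
    simp [abs_of_nonpos (Set.mem_Iic.1 hx)]
  · refine (integrableOn_exp_mul_Ioi (neg_lt_zero.2 hc) 0).congr_fun (fun x hx => ?_)
      measurableSet_Ioi
    simp [abs_of_pos (Set.mem_Ioi.1 hx)]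

/-- The factor `exp t` turns an asymptotic bound at `0⁺` into a bound on the whole half-line. -/
lemma exists_div_le_mul_exp {F : ℝ → ℝ} (hF1 : ∀ t, F t ≤ 1)
    {A C d b : ℝ} (hA : 0 < A) (hC : 0 < C) (hd : 0 < d)
    (hF : Tendsto (fun t : ℝ => F t / (A * t ^ b * exp (-C / t ^ d)))
      (nhdsWithin 0 (Set.Ioi 0)) (nhds 1)) :
    ∃ K : ℝ, 0 < K ∧ ∀ t, 0 < t → F t / (A * t ^ b * exp (-C / t ^ d)) ≤ K * exp t := by
  have hev := hF.eventually (gt_mem_nhds (one_lt_two))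
  obtain ⟨δ, hδ, h⟩ := mem_nhdsGT_iff_exists_Ioo_subset.1 hev
  have hδ0 : 0 < δ := hδ
  obtain ⟨L, hL, hLb⟩ : ∃ L : ℝ, 0 < L ∧ ∀ t, δ ≤ t → t ^ (-b) ≤ L * exp t := by
    rcases le_total 0 (-b) with hb | hb
    · obtain ⟨K, hK, h⟩ := exists_rpow_le_mul_exp hb one_pos
      exact ⟨K, hK, fun t ht => by simpa using h t (hδ0.trans_le ht)⟩
    · refine ⟨δ ^ (-b), by positivity, fun t ht => ?_⟩
      have h1 : (1 : ℝ) ≤ exp t := one_le_exp (hδ0.le.trans ht)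
      have h2 := rpow_le_rpow_of_nonpos hδ0 ht hb
      exact h2.trans (le_mul_of_one_le_right (by positivity) h1)
  refine ⟨max 2 (A⁻¹ * exp (C / δ ^ d) * L), by positivity, fun t ht => ?_⟩
  rcases lt_or_ge t δ with htδ | htδ
  · have h1 : F t / (A * t ^ b * exp (-C / t ^ d)) < 2 := h ⟨ht, htδ⟩
    calc _ ≤ 2 := h1.le
      _ ≤ max 2 (A⁻¹ * exp (C / δ ^ d) * L) * 1 := by simp
      _ ≤ _ := by
        gcongr
        exact one_le_exp ht.le
  · calc F t / (A * t ^ b * exp (-C / t ^ d))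
        ≤ 1 / (A * t ^ b * exp (-C / t ^ d)) := by
          gcongr
          exact hF1 t
      _ = A⁻¹ * exp (C / t ^ d) * t ^ (-b) := by
          rw [rpow_neg ht.le, neg_div, exp_neg]
          field_simp
      _ ≤ A⁻¹ * exp (C / δ ^ d) * (L * exp t) := by
          gcongr
          exact hLb t htδ
      _ ≤ _ := by
          rw [← mul_assoc]
          gcongr
          exact le_max_right _ _

/-- Rescaling the integrand around its saddle point `s`: the large parameter is `C * d / s ^ d`. -/
lemma rescaled_eq_mul_exp_laplacePhase (F : ℝ → ℝ) {A C d b s u : ℝ} (hA : 0 < A)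
    (hd : 0 < d) (hs : 0 < s) (hu : 0 < u) :
    F (s * u) * exp (-(C * d / s ^ d) * (u - 1 - 1 / d)) / (A * s ^ b) =
      F (s * u) / (A * (s * u) ^ b * exp (-C / (s * u) ^ d)) *
        (u ^ b * exp (-(C * d / s ^ d * laplacePhase d u))) := by
  have h : exp (-(C * d / s ^ d) * (u - 1 - 1 / d)) * exp (-C / (s * u) ^ d) =
      exp (-(C * d / s ^ d * laplacePhase d u)) := by
    rw [← exp_add]
    congr 1
    have := (rpow_pos_of_pos hs d).ne'
    have := (rpow_pos_of_pos hu d).ne'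
    rw [laplacePhase, mul_rpow hs.le hu.le, rpow_neg hu.le]
    field_simp
    ring
  rw [← h, mul_rpow hs.le hu.le]
  have := (rpow_pos_of_pos hs b).ne'
  have := (rpow_pos_of_pos hu b).ne'
  have := (exp_pos (-C / (s * u) ^ d)).ne'
  field_simp

lemma tendsto_integral_rescaled {F : ℝ → ℝ} (hFm : Measurable F) (hF0 : ∀ t, 0 ≤ F t)
    (hF1 : ∀ t, F t ≤ 1) (hFneg : ∀ t ≤ 0, F t = 0)
    {A C d b : ℝ} (hA : 0 < A) (hC : 0 < C) (hd : 0 < d)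
    (hF : Tendsto (fun t : ℝ => F t / (A * t ^ b * exp (-C / t ^ d)))
      (nhdsWithin 0 (Set.Ioi 0)) (nhds 1)) :
    Tendsto (fun s : ℝ => ∫ v, F (s * (1 + v / √(C * d / s ^ d))) *
        exp (-(C * d / s ^ d) * (1 + v / √(C * d / s ^ d) - 1 - 1 / d)) / (A * s ^ b))
      (nhdsWithin 0 (Set.Ioi 0)) (nhds √(2 * π / (d + 1))) := by
  obtain ⟨K, hK, hKb⟩ := exists_div_le_mul_exp hF1 hA hC hd hF
  obtain ⟨L, hL, hLb⟩ := exists_rpow_mul_exp_le hd b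
  have hpos : ∀ᶠ s : ℝ in nhdsWithin 0 (Set.Ioi 0), 0 < s := self_mem_nhdsWithin
  have hM : Tendsto (fun s : ℝ => C * d / s ^ d) (nhdsWithin 0 (Set.Ioi 0)) atTop := by
    have h := ((tendsto_rpow_atTop hd).comp tendsto_inv_nhdsGT_zero).const_mul_atTop
      (mul_pos hC hd)
    refine h.congr' ?_
    filter_upwards [hpos] with s hs
    simp [Function.comp, inv_rpow hs.le, div_eq_mul_inv]
  have hgauss : √(2 * π / (d + 1)) = ∫ v : ℝ, exp (-((d + 1) / 2) * v ^ 2) := by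
    rw [integral_gaussian]
    congr 1
    field_simp
  rw [hgauss]
  refine tendsto_integral_filter_of_dominated_convergence
    (fun v => K * L * exp (1 / 8) * exp (-(1 / 8) * |v|)) ?_ ?_
    ((integrable_exp_neg_mul_abs (by norm_num)).const_mul _) ?_
  · exact .of_forall fun s => Measurable.aestronglyMeasurable (by fun_prop)
  · have hs1 : ∀ᶠ s : ℝ in nhdsWithin 0 (Set.Ioi 0), s < 1 :=
      nhdsWithin_le_nhds (gt_mem_nhds one_pos)
    filter_upwards [hpos, hs1, hM.eventually_ge_atTop 4] with s hs hs1 hM4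
    refine .of_forall fun v => ?_
    rcases le_or_gt (1 + v / √(C * d / s ^ d)) 0 with hu | hu
    · rw [hFneg _ (mul_nonpos_of_nonneg_of_nonpos hs.le hu)]
      simp only [zero_mul, zero_div, norm_zero]
      positivity
    have hnn := hF0 (s * (1 + v / √(C * d / s ^ d)))
    rw [norm_of_nonneg (by positivity), rescaled_eq_mul_exp_laplacePhase F hA hd hs hu]
    have hphase := sq_div_le_laplacePhase hd hu
    generalize C * d / s ^ d = M at *
    have hMpos : 0 < M := by linarith
    have hsqrt : 1 ≤ √M := one_le_sqrt.2 (by linarith)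
    have hquad : |v| - 1 ≤ 4 * (M * laplacePhase d (1 + v / √M)) := by
      rw [add_sub_cancel_left] at hphase
      have hle : |v / √M| ≤ |v| := by
        rw [abs_div, abs_of_nonneg (sqrt_nonneg M)]
        exact div_le_self (abs_nonneg v) hsqrt
      calc |v| - 1 ≤ v ^ 2 / (1 + |v|) := by
            rw [le_div_iff₀ (by positivity), ← sq_abs v]
            nlinarith
        _ = 4 * (M * ((v / √M) ^ 2 / (4 * (1 + |v|)))) := by
            rw [div_pow, sq_sqrt hMpos.le]
            field_simp
        _ ≤ 4 * (M * ((v / √M) ^ 2 / (4 * (1 + |v / √M|)))) := by gcongr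
        _ ≤ _ := by gcongr
    generalize 1 + v / √M = u at *
    have h0 := laplacePhase_nonneg hd hu
    calc F (s * u) / (A * (s * u) ^ b * exp (-C / (s * u) ^ d)) *
          (u ^ b * exp (-(M * laplacePhase d u)))
        ≤ K * exp u * (u ^ b * (exp (-2 * laplacePhase d u) * exp (1 / 8 - 1 / 8 * |v|))) := by
          gcongr
          · refine (hKb _ (mul_pos hs hu)).trans ?_
            gcongr
            nlinarith
          · rw [← exp_add]
            gcongr
            nlinarith
      _ = K * (u ^ b * exp u * exp (-2 * laplacePhase d u)) * exp (1 / 8 - 1 / 8 * |v|) := by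
          ring
      _ ≤ K * L * exp (1 / 8 - 1 / 8 * |v|) := by
          gcongr
          exact hLb u hu
      _ = _ := by
          rw [mul_assoc _ (exp _), ← exp_add]
          ring_nf
  · refine .of_forall fun v => ?_
    have hu : Tendsto (fun s : ℝ => 1 + v / √(C * d / s ^ d)) (nhdsWithin 0 (Set.Ioi 0))
        (nhds 1) := by
      simpa using ((tendsto_sqrt_atTop.comp hM).const_div_atTop v).const_add 1
    have hupos := hu.eventually (lt_mem_nhds one_pos)
    have hsu : Tendsto (fun s : ℝ => s * (1 + v / √(C * d / s ^ d))) (nhdsWithin 0 (Set.Ioi 0))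
        (nhdsWithin 0 (Set.Ioi 0)) := by
      refine tendsto_nhdsWithin_iff.2 ⟨?_, ?_⟩
      · simpa using (tendsto_id.mono_left nhdsWithin_le_nhds).mul hu
      · filter_upwards [hpos, hupos] with s hs hu
        exact mul_pos hs hu
    have hphase := (((tendsto_mul_laplacePhase hd v).comp hM).neg).rexp
    have hpow := hu.rpow_const (p := b) (Or.inl one_ne_zero)
    have h := (hF.comp hsu).mul (hpow.mul hphase)
    rw [one_rpow, one_mul, one_mul, ← neg_mul] at h
    refine h.congr' ?_
    filter_upwards [hpos, hupos] with s hs hu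
    exact (rescaled_eq_mul_exp_laplacePhase F hA hd hs hu).symm

/-- Centring an integral at `s` and rescaling it by `s / √M`, where `M = r * s`. -/
lemma integral_mul_exp_eq_integral_rescaled (F : ℝ → ℝ) {r s M B : ℝ} (c : ℝ) (hs : 0 < s)
    (hM : 0 < M) (hrM : r * s = M) (hB : B ≠ 0) :
    ∫ t, r * exp (-r * t) * F t =
      B * √M * exp (-M * (1 + c)) *
        ∫ v, F (s * (1 + v / √M)) * exp (-M * (1 + v / √M - 1 - c)) / B := by
  have hsqrt := sqrt_pos.2 hM
  have h1 := Measure.integral_comp_mul_left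
    (fun t => r * exp (-r * (s + t)) * F (s + t)) (s / √M)
  rw [integral_add_left_eq_self (fun t => r * exp (-r * t) * F t) s,
    abs_of_pos (by positivity), smul_eq_mul, inv_div] at h1
  have h2 : ∫ t, r * exp (-r * t) * F t = s / √M *
      ∫ v, r * exp (-r * (s + s / √M * v)) * F (s + s / √M * v) := by
    rw [h1]
    field_simp
  rw [h2, ← integral_const_mul, ← integral_const_mul]
  congr 1 with v
  have e1 : s + s / √M * v = s * (1 + v / √M) := by ring
  have e2 : exp (-r * (s * (1 + v / √M))) =
      exp (-M * (1 + c)) * exp (-M * (1 + v / √M - 1 - c)) := by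
    rw [← exp_add, ← hrM]
    ring_nf
  have e3 : s / √M * r = √M := by
    rw [div_mul_eq_mul_div, mul_comm s r, hrM, div_sqrt]
  rw [e1, e2]
  calc _ = (s / √M * r) * (exp (-M * (1 + c)) * exp (-M * (1 + v / √M - 1 - c))) *
        F (s * (1 + v / √M)) := by ring
    _ = _ := by
      rw [e3]
      field_simp

lemma saddle_asymptotics_eq {A C d b r : ℝ} (hA : 0 < A) (hC : 0 < C) (hd : 0 < d)
    (hr : 0 < r) :
    √(2 * π * A ^ 2 * (C * d) ^ ((2 * b + 1) / (d + 1)) / (d + 1)) *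
        r ^ ((d - 2 * b) / (2 * d + 2)) *
        exp (-(((d + 1) / d ^ (d / (d + 1))) * C ^ (1 / (d + 1))) * r ^ (d / (d + 1))) =
      A * ((C * d / r) ^ (1 / (d + 1))) ^ b * √(r * (C * d / r) ^ (1 / (d + 1))) *
        exp (-(r * (C * d / r) ^ (1 / (d + 1))) * (1 + 1 / d)) * √(2 * π / (d + 1)) := by
  have hd1 : 0 < d + 1 := by linarith
  have hexp : ((d + 1) / d ^ (d / (d + 1))) * C ^ (1 / (d + 1)) * r ^ (d / (d + 1)) =
      r * (C * d / r) ^ (1 / (d + 1)) * (1 + 1 / d) := by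
    have e : d / (d + 1) = 1 - 1 / (d + 1) := by
      field_simp
      ring
    have := (rpow_pos_of_pos hd (1 / (d + 1))).ne'
    have := (rpow_pos_of_pos hr (1 / (d + 1))).ne'
    rw [e, div_rpow (by positivity) hr.le, mul_rpow hC.le hd.le, rpow_sub hd, rpow_sub hr,
      rpow_one, rpow_one]
    field_simp
  have hpre : √(2 * π * A ^ 2 * (C * d) ^ ((2 * b + 1) / (d + 1)) / (d + 1)) *
        r ^ ((d - 2 * b) / (2 * d + 2)) =
      A * ((C * d / r) ^ (1 / (d + 1))) ^ b * √(r * (C * d / r) ^ (1 / (d + 1))) *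
        √(2 * π / (d + 1)) := by
    have e : 2 * π * A ^ 2 * (C * d) ^ ((2 * b + 1) / (d + 1)) / (d + 1) =
        A ^ 2 * ((C * d) ^ ((2 * b + 1) / (d + 1)) * (2 * π / (d + 1))) := by ring
    have hCd : 0 < C * d := by positivity
    rw [e, sqrt_mul (by positivity), sqrt_sq hA.le, sqrt_mul (by positivity),
      sqrt_mul hr.le, sqrt_eq_rpow r, sqrt_eq_rpow ((C * d) ^ _),
      sqrt_eq_rpow ((C * d / r) ^ _), ← rpow_mul (by positivity), ← rpow_mul (by positivity),
      ← rpow_mul (by positivity), div_rpow hCd.le hr.le, div_rpow hCd.le hr.le]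
    have e1 : (C * d) ^ ((2 * b + 1) / (d + 1) * (1 / 2)) =
        (C * d) ^ (1 / (d + 1) * b) * (C * d) ^ (1 / (d + 1) * (1 / 2)) := by
      rw [← rpow_add hCd]
      congr 1
      field_simp
    have e2 : r ^ ((d - 2 * b) / (2 * d + 2)) =
        r ^ (1 / 2 : ℝ) / (r ^ (1 / (d + 1) * b) * r ^ (1 / (d + 1) * (1 / 2))) := by
      rw [← rpow_add hr, ← rpow_sub hr]
      congr 1
      field_simp
      ring
    rw [e1, e2]
    field_simp
  rw [hpre, neg_mul, hexp, neg_mul]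
  ring

theorem success_prob_sharp_asymptotics
    {Ω : Type*} [MeasureSpace Ω] [IsProbabilityMeasure (ℙ : Measure Ω)]
    (τ : Ω → ℝ) (hτm : Measurable τ) (hτpos : ℙ {ω | τ ω ≤ 0} = 0)
    (A C d b : ℝ) (hA : 0 < A) (hC : 0 < C) (hd : 0 < d)
    (hF : Tendsto (fun t : ℝ =>
        (ℙ {ω | τ ω ≤ t}).toReal / (A * t ^ b * Real.exp (-C / t ^ d)))
      (nhdsWithin 0 (Set.Ioi 0)) (nhds 1))
    (μ β γ : ℝ)
    (hμ : μ = Real.sqrt (2 * π * A ^ 2 * (C * d) ^ ((2 * b + 1) / (d + 1)) / (d + 1)))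
    (hβ : β = (d - 2 * b) / (2 * d + 2))
    (hγ : γ = ((d + 1) / d ^ (d / (d + 1))) * C ^ (1 / (d + 1))) :
    Tendsto (fun r : ℝ =>
        (∫ ω, Real.exp (-r * τ ω) ∂ℙ) /
          (μ * r ^ β * Real.exp (-γ * r ^ (d / (d + 1)))))
      atTop (nhds 1) := by
  have hFm : Measurable fun t : ℝ => (ℙ {ω | τ ω ≤ t}).toReal := by
    refine (Monotone.measurable ?_).ennreal_toReal
    intro s t hst
    exact measure_mono fun ω (h : τ ω ≤ s) => h.trans hst
  have hlim := tendsto_integral_rescaled hFm (fun _ => ENNReal.toReal_nonneg)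
    (fun _ => measureReal_le_one)
    (fun t ht => by
      have h : ℙ {ω | τ ω ≤ t} = 0 :=
        measure_mono_null (fun ω (h : τ ω ≤ t) => h.trans ht) hτpos
      rw [h, ENNReal.toReal_zero])
    hA hC hd hF
  have hd1 : 0 < d + 1 := by linarith
  have hs : Tendsto (fun r : ℝ => (C * d / r) ^ (1 / (d + 1))) atTop
      (nhdsWithin 0 (Set.Ioi 0)) := by
    refine tendsto_nhdsWithin_iff.2 ⟨?_, ?_⟩
    · have h := (tendsto_id.const_div_atTop (C * d)).rpow_const
        (p := 1 / (d + 1)) (Or.inr (by positivity))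
      rwa [zero_rpow (by positivity)] at h
    · filter_upwards [eventually_gt_atTop 0] with r hr
      exact rpow_pos_of_pos (by positivity) _
  have hσ : √(2 * π / (d + 1)) ≠ 0 := by positivity
  have h := (hlim.comp hs).div_const √(2 * π / (d + 1))
  rw [div_self hσ] at h
  refine h.congr' ?_
  filter_upwards [eventually_gt_atTop 0] with r hr
  have hspos : 0 < (C * d / r) ^ (1 / (d + 1)) := by positivity
  have hM : C * d / ((C * d / r) ^ (1 / (d + 1))) ^ d = r * (C * d / r) ^ (1 / (d + 1)) := by
    have hpow : ((C * d / r) ^ (1 / (d + 1))) ^ (d + 1) = C * d / r := by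
      rw [← rpow_mul (by positivity), one_div_mul_cancel hd1.ne', rpow_one]
    rw [rpow_add_one hspos.ne', eq_div_iff hr.ne'] at hpow
    rw [div_eq_iff (by positivity)]
    linarith
  rw [hμ, hβ, hγ, saddle_asymptotics_eq hA hC hd hr,
    integral_exp_neg_mul_eq_integral_cdf ℙ hτm hr,
    integral_mul_exp_eq_integral_rescaled _ (1 / d) hspos (by positivity) rfl
      (B := A * ((C * d / r) ^ (1 / (d + 1))) ^ b) (by positivity)]
  simp only [Function.comp, hM]
  rw [mul_div_mul_left _ _ (by positivity)]
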